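/- Failure of the reverse isoperimetric inequality without convexity (counterexample of Section 5.1, perimeter constraint): Let r > 0 and let x₁, x₂ ∈ ℝ² with |x₁ − x₂| > 2r, so that Ω := B_r(x₁) ∪ B_r(x₂) is the union of two open disks of radius r with disjoint closures. Let B_{R₁} be an open disk of radius R₁ = 2r, so that H¹(∂B_{R₁}) = H¹(∂Ω). Then there exists α₀ < 0 such that for every α < α₀ one has the reverse strict inequality λ₁^α(B_{R₁}^ext) < λ₁^α(Ω^ext). -/

import Mathlib

open MeasureTheory Metric Set Bornology Real Filter

noncomputable section

/-- The Euclidean plane. -/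
abbrev E2 := EuclideanSpace ℝ (Fin 2)

/-- The exterior of a set: complement of its closure. -/
def extDom (Ω : Set E2) : Set E2 := (closure Ω)ᶜ

/-- The lowest Robin eigenvalue of the exterior of `Ω`, defined variationally as the
infimum of Rayleigh quotients over smooth compactly supported test functions that are
not identically zero on the exterior. -/
def robinEig (α : ℝ) (Ω : Set E2) : ℝ :=
  sInf { q : ℝ | ∃ u : E2 → ℝ, ContDiff ℝ (⊤ : ℕ∞) u ∧ HasCompactSupport u ∧
    (∃ x ∈ extDom Ω, u x ≠ 0) ∧
    q = ((∫ x in extDom Ω, ‖fderiv ℝ u x‖ ^ 2) +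
          α * ∫ x in frontier Ω, (u x) ^ 2 ∂(μH[1])) /
        (∫ x in extDom Ω, (u x) ^ 2) }

/-- A planar set has smooth boundary if its topological boundary is the image of a
smooth, periodic, regular, injective (on one period) closed curve. -/
def HasSmoothBoundary (Ω : Set E2) : Prop :=
  ∃ γ : ℝ → E2, ContDiff ℝ (⊤ : ℕ∞) γ ∧ (∀ t, γ (t + 1) = γ t) ∧
    (∀ t, deriv γ t ≠ 0) ∧ InjOn γ (Ico 0 1) ∧ range γ = frontier Ω


open scoped Pointwise ENNReal NNReal

/-- The cone measure on the unit circle of `ℂ` is invariant under rotations. -/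
instance isMulLeftInvariant_toSphere :
    Measure.IsMulLeftInvariant (volume : Measure ℂ).toSphere where
  map_mul_left_eq_self z := by
    ext s hs
    have hm : Measurable fun w : sphere (0 : ℂ) 1 => z * w := (continuous_const_mul z).measurable
    rw [Measure.map_apply hm hs, Measure.toSphere_apply' _ (hm hs), Measure.toSphere_apply' _ hs]
    congr 1
    have hz : ‖(z : ℂ)‖ = 1 := by simp
    have hz0 : (z : ℂ) ≠ 0 := fun h => by simp [h] at hz
    let e := rotation ⟨z, mem_sphere_zero_iff_norm.2 hz⟩
    have he : ∀ w, e w = z * w := fun w => rfl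
    rw [← e.measurePreserving.measure_preimage_emb e.toHomeomorph.measurableEmbedding
      (Ioo (0 : ℝ) 1 • (Subtype.val '' s))]
    congr 1
    ext w
    simp only [Set.mem_smul, mem_image, mem_preimage, he]
    constructor
    · rintro ⟨t, ht, _, ⟨v, hv, rfl⟩, rfl⟩
      exact ⟨t, ht, _, ⟨_, hv, rfl⟩, by simp [mul_left_comm]⟩
    · rintro ⟨t, ht, _, ⟨v, hv, rfl⟩, h⟩
      refine ⟨t, ht, _, ⟨z⁻¹ * v, by simpa using hv, rfl⟩, mul_left_cancel₀ hz0 ?_⟩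
      rw [← h]
      simp only [Metric.unitSphere.coe_mul, Metric.unitSphere.coe_inv, Complex.real_smul]
      field_simp

instance isMulLeftInvariant_hausdorffMeasure_circle :
    Measure.IsMulLeftInvariant (μH[1] : Measure (sphere (0 : ℂ) 1)) where
  map_mul_left_eq_self z := by
    have h : Isometry (Equiv.mulLeft z) := Isometry.of_dist_eq fun w w' => by
      have hz : ‖(z : ℂ)‖ = 1 := by simp
      simp [Subtype.dist_eq, dist_eq_norm, ← mul_sub, hz]
    exact (IsometryEquiv.mk _ h).map_hausdorffMeasure 1

lemma hausdorffMeasure_circle_eq_sphere :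
    (μH[1] : Measure (sphere (0 : ℂ) 1)) univ = μH[1] (sphere (0 : ℂ) 1) := by
  rw [← isometry_subtype_coe.hausdorffMeasure_image (Or.inl zero_le_one), image_univ,
    Subtype.range_coe]

instance isFiniteMeasure_hausdorffMeasure_circle :
    IsFiniteMeasure (μH[1] : Measure (sphere (0 : ℂ) 1)) where
  measure_univ_lt_top := by
    rw [hausdorffMeasure_circle_eq_sphere]
    have h := (lipschitzWith_circleMap 0 1).hausdorffMeasure_image_le zero_le_one (Ioc 0 (2 * π))
    rw [image_circleMap_Ioc, hausdorffMeasure_real] at h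
    rw [abs_one] at h
    refine h.trans_lt ?_
    simp [ENNReal.mul_lt_top_iff]

lemma hausdorffMeasure_circle_ne_zero : (μH[1] : Measure (sphere (0 : ℂ) 1)) ≠ 0 := by
  intro h
  have h0 : (μH[1] : Measure (sphere (0 : ℂ) 1)) univ = 0 := by simp [h]
  rw [hausdorffMeasure_circle_eq_sphere] at h0
  have hl : LipschitzWith 1 Complex.re := LipschitzWith.of_dist_le_mul fun z w => by
    simpa [Real.dist_eq, dist_eq_norm] using Complex.abs_re_le_norm (z - w)
  have h1 := hl.hausdorffMeasure_image_le zero_le_one (sphere (0 : ℂ) 1)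
  rw [h0, hausdorffMeasure_real] at h1
  have h2 : Icc (-1 : ℝ) 1 ⊆ Complex.re '' sphere (0 : ℂ) 1 := fun t ht => by
    refine ⟨⟨t, √(1 - t ^ 2)⟩, ?_, rfl⟩
    have : 0 ≤ 1 - t ^ 2 := by nlinarith [ht.1, ht.2]
    simp [Complex.norm_def, Complex.normSq_mk, ← sq, Real.sq_sqrt this]
  have h3 := (measure_mono h2).trans h1
  norm_num at h3

/-- Arc length on the unit circle is a positive multiple of the cone measure. -/
lemma exists_hausdorffMeasure_circle_eq_smul :
    ∃ C : ℝ≥0, 0 < C ∧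
      (μH[1] : Measure (sphere (0 : ℂ) 1)) = C • (volume : Measure ℂ).toSphere := by
  have : Measure.IsHaarMeasure (volume : Measure ℂ).toSphere := {}
  have h := Measure.isMulInvariant_eq_smul_of_compactSpace
    (μH[1] : Measure (sphere (0 : ℂ) 1)) (volume : Measure ℂ).toSphere
  refine ⟨_, pos_iff_ne_zero.2 fun h0 => hausdorffMeasure_circle_ne_zero ?_, h⟩
  rw [h, h0, zero_smul]

/-- The standard isometry between `ℂ` and the Euclidean plane. -/
def complexIsometry : ℂ ≃ₗᵢ[ℝ] E2 := Complex.orthonormalBasisOneI.repr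

/-- The parametrization of the circle of radius `ρ` around `x` by the unit circle of `ℂ`. -/
def circlePoint (x : E2) (ρ : ℝ) (ω : sphere (0 : ℂ) 1) : E2 := x + ρ • complexIsometry ω

lemma continuous_circlePoint (x : E2) :
    Continuous fun p : sphere (0 : ℂ) 1 × ℝ => circlePoint x p.2 p.1 := by
  unfold circlePoint
  have := complexIsometry.continuous
  fun_prop

lemma range_circlePoint (x : E2) {ρ : ℝ} (hρ : 0 < ρ) :
    range (circlePoint x ρ) = sphere x ρ := by
  ext y
  simp only [mem_range, mem_sphere_iff_norm, circlePoint]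
  constructor
  · rintro ⟨ω, rfl⟩
    have : ‖(ω : ℂ)‖ = 1 := by simp
    simp [norm_smul, this, abs_of_pos hρ]
  · intro h
    refine ⟨⟨complexIsometry.symm (ρ⁻¹ • (y - x)), ?_⟩, ?_⟩
    · rw [mem_sphere_zero_iff_norm, complexIsometry.symm.norm_map, norm_smul, h, norm_inv,
        Real.norm_of_nonneg hρ.le, inv_mul_cancel₀ hρ.ne']
    · rw [complexIsometry.apply_symm_apply, smul_inv_smul₀ hρ.ne', add_sub_cancel]

lemma hausdorffMeasure_circlePoint_image (x : E2) {ρ : ℝ} (hρ : 0 < ρ)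
    (s : Set (sphere (0 : ℂ) 1)) :
    μH[1] (circlePoint x ρ '' s) = ENNReal.ofReal ρ * μH[1] s := by
  have hι : Isometry fun ω : sphere (0 : ℂ) 1 => x + complexIsometry ω :=
    (IsometryEquiv.addLeft x).isometry.comp
      (complexIsometry.isometry.comp isometry_subtype_coe)
  have h := hausdorffMeasure_homothety_image (zero_le_one' ℝ) x hρ.ne'
    ((fun ω : sphere (0 : ℂ) 1 => x + complexIsometry ω) '' s)
  rw [hι.hausdorffMeasure_image (Or.inl zero_le_one), image_image] at h
  have he : (fun ω : sphere (0 : ℂ) 1 =>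
      AffineMap.homothety x ρ (x + complexIsometry ω)) = circlePoint x ρ := by
    ext1 ω
    simp [AffineMap.homothety_apply, circlePoint, add_comm]
  rw [he] at h
  rw [h, NNReal.rpow_one, ENNReal.smul_def, smul_eq_mul, ← enorm_eq_nnnorm,
    Real.enorm_eq_ofReal hρ.le]

/-- A common positive constant relates integrals over all circles with respect to arc length
to integrals over the unit circle with respect to the cone measure. -/
lemma exists_hausdorffMeasure_restrict_sphere :
    ∃ C : ℝ, 0 < C ∧ ∀ (x : E2) (ρ : ℝ), 0 < ρ →
      (μH[1] : Measure E2).restrict (sphere x ρ) =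
        ENNReal.ofReal (C * ρ) • (volume : Measure ℂ).toSphere.map (circlePoint x ρ) := by
  obtain ⟨C, hC, h⟩ := exists_hausdorffMeasure_circle_eq_smul
  refine ⟨C, by exact_mod_cast hC, fun x ρ hρ => ?_⟩
  have hm : Measurable (circlePoint x ρ) :=
    ((continuous_circlePoint x).comp (Continuous.prodMk_left ρ)).measurable
  ext s hs
  rw [Measure.restrict_apply hs, Measure.smul_apply, Measure.map_apply hm hs,
    ← range_circlePoint x hρ, ← image_preimage_eq_inter_range,
    hausdorffMeasure_circlePoint_image x hρ, h, ENNReal.ofReal_mul (by positivity)]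
  simp only [Measure.smul_apply, smul_eq_mul, ENNReal.ofReal_coe_nnreal, ENNReal.smul_def]
  ring

lemma measurable_circlePoint (x : E2) (ρ : ℝ) : Measurable (circlePoint x ρ) :=
  ((continuous_circlePoint x).comp (Continuous.prodMk_left ρ)).measurable

lemma integrable_comp_circlePoint {f : E2 → ℝ} (hf : Continuous f) (x : E2) (ρ : ℝ) :
    Integrable (fun ω => f (circlePoint x ρ ω)) (volume : Measure ℂ).toSphere :=
  ((hf.comp (continuous_circlePoint x)).comp
    (Continuous.prodMk_left ρ)).integrable_of_hasCompactSupport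
      (HasCompactSupport.of_compactSpace _)

lemma integrableOn_sphere_hausdorffMeasure {C : ℝ} {x : E2} {ρ : ℝ}
    (h : (μH[1] : Measure E2).restrict (sphere x ρ) =
      ENNReal.ofReal (C * ρ) • (volume : Measure ℂ).toSphere.map (circlePoint x ρ))
    {f : E2 → ℝ} (hf : Continuous f) : IntegrableOn f (sphere x ρ) μH[1] := by
  rw [IntegrableOn, h]
  refine Integrable.smul_measure ?_ ENNReal.ofReal_ne_top
  rw [integrable_map_measure hf.aestronglyMeasurable (measurable_circlePoint x ρ).aemeasurable]
  exact integrable_comp_circlePoint hf x ρ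

lemma setIntegral_sphere_hausdorffMeasure {C : ℝ} (hC : 0 < C) {x : E2} {ρ : ℝ} (hρ : 0 < ρ)
    (h : (μH[1] : Measure E2).restrict (sphere x ρ) =
      ENNReal.ofReal (C * ρ) • (volume : Measure ℂ).toSphere.map (circlePoint x ρ))
    {f : E2 → ℝ} (hf : Continuous f) :
    ∫ y in sphere x ρ, f y ∂μH[1] =
      C * ρ * ∫ ω, f (circlePoint x ρ ω) ∂(volume : Measure ℂ).toSphere := by
  rw [h, integral_smul_measure, integral_map (measurable_circlePoint x ρ).aemeasurable
    hf.aestronglyMeasurable, ENNReal.toReal_ofReal (by positivity), smul_eq_mul]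

lemma setIntegral_volumeIoiPow_one (g : ℝ → ℝ) :
    ∫ ρ : Ioi (0 : ℝ), g ρ ∂(Measure.volumeIoiPow 1) = ∫ ρ in Ioi (0 : ℝ), ρ * g ρ := by
  simp only [Measure.volumeIoiPow, ENNReal.ofReal]
  rw [integral_withDensity_eq_integral_smul (measurable_subtype_coe.pow_const _).real_toNNReal,
    integral_subtype_comap measurableSet_Ioi fun a ↦ Real.toNNReal (a ^ 1) • g a,
    setIntegral_congr_fun measurableSet_Ioi fun ρ hρ ↦ ?_]
  simp [NNReal.smul_def, max_eq_left (le_of_lt (mem_Ioi.1 hρ))]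

/-- Integration in polar coordinates on `ℂ`. -/
lemma integral_complex_eq_integral_toSphere {g : ℂ → ℝ} (hg : Integrable g) :
    Integrable (fun ω : sphere (0 : ℂ) 1 => ∫ ρ in Ioi (0 : ℝ), ρ * g (ρ • (ω : ℂ)))
        (volume : Measure ℂ).toSphere ∧
      ∫ z, g z = ∫ ω : sphere (0 : ℂ) 1, (∫ ρ in Ioi (0 : ℝ), ρ * g (ρ • (ω : ℂ)))
        ∂(volume : Measure ℂ).toSphere := by
  have hmp := (volume : Measure ℂ).measurePreserving_homeomorphUnitSphereProd
  have hemb := (homeomorphUnitSphereProd ℂ).measurableEmbedding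
  have hdim : Module.finrank ℝ ℂ - 1 = 1 := by simp
  rw [hdim] at hmp
  let G : sphere (0 : ℂ) 1 × Ioi (0 : ℝ) → ℝ := fun p => g ((p.2 : ℝ) • (p.1 : ℂ))
  have hG : ∀ z, G (homeomorphUnitSphereProd ℂ z) = g z := fun z => by
    have := congrArg Subtype.val ((homeomorphUnitSphereProd ℂ).symm_apply_apply z)
    simp only [homeomorphUnitSphereProd_symm_apply_coe] at this
    simp only [G, this]
  have hint : Integrable G ((volume : Measure ℂ).toSphere.prod (Measure.volumeIoiPow 1)) := by
    rw [← hmp.integrable_comp_emb hemb]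
    have : G ∘ homeomorphUnitSphereProd ℂ = g ∘ Subtype.val := funext hG
    rw [this, ← integrableOn_iff_comap_subtypeVal (measurableSet_singleton _).compl]
    exact hg.integrableOn
  simp only [← setIntegral_volumeIoiPow_one]
  refine ⟨hint.integral_prod_left, ?_⟩
  have h0 : ∫ z, g z = ∫ z in ({0}ᶜ : Set ℂ), g z := by rw [restrict_compl_singleton]
  rw [h0, ← integral_subtype_comap (measurableSet_singleton _).compl g]
  simp only [← hG]
  rw [hmp.integral_comp hemb, integral_prod _ hint]

/-- Integration in polar coordinates around a point of the Euclidean plane. -/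
lemma integral_eq_integral_circlePoint {f : E2 → ℝ} (hf : Integrable f) (x : E2) :
    Integrable (fun ω => ∫ ρ in Ioi (0 : ℝ), ρ * f (circlePoint x ρ ω))
        (volume : Measure ℂ).toSphere ∧
      ∫ y, f y = ∫ ω, (∫ ρ in Ioi (0 : ℝ), ρ * f (circlePoint x ρ ω))
        ∂(volume : Measure ℂ).toSphere := by
  have hmp : MeasurePreserving (fun z => x + complexIsometry z) :=
    (measurePreserving_add_left volume x).comp complexIsometry.measurePreserving
  have hemb : MeasurableEmbedding (fun z => x + complexIsometry z) :=
    (measurableEmbedding_addLeft x).comp complexIsometry.toHomeomorph.measurableEmbedding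
  have h := integral_complex_eq_integral_toSphere ((hmp.integrable_comp_emb hemb).2 hf)
  rw [← hmp.integral_comp hemb f]
  simpa only [Function.comp_apply, map_smul, circlePoint] using h

lemma dist_circlePoint (x : E2) {ρ : ℝ} (hρ : 0 ≤ ρ) (ω : sphere (0 : ℂ) 1) :
    dist (circlePoint x ρ ω) x = ρ := by
  have : ‖(ω : ℂ)‖ = 1 := by simp
  simp [circlePoint, norm_smul, this, abs_of_nonneg hρ]

/-- Polar coordinates on the set of points whose distance to `x` lies in `I`. -/
lemma setIntegral_dist_mem {f : E2 → ℝ} (x : E2) {I : Set ℝ} (hI : MeasurableSet I)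
    (hI0 : I ⊆ Ioi 0) (hf : IntegrableOn f {y | dist y x ∈ I}) :
    Integrable (fun ω => ∫ ρ in I, ρ * f (circlePoint x ρ ω)) (volume : Measure ℂ).toSphere ∧
      ∫ y in {y | dist y x ∈ I}, f y = ∫ ω, (∫ ρ in I, ρ * f (circlePoint x ρ ω))
        ∂(volume : Measure ℂ).toSphere := by
  have hA : MeasurableSet {y | dist y x ∈ I} :=
    (continuous_id.dist continuous_const).measurable hI
  have h := integral_eq_integral_circlePoint ((integrable_indicator_iff hA).2 hf) x
  rw [integral_indicator hA] at h
  have hin : ∀ ω, ∫ ρ in Ioi (0 : ℝ),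
      ρ * ({y | dist y x ∈ I}.indicator f (circlePoint x ρ ω)) =
        ∫ ρ in I, ρ * f (circlePoint x ρ ω) := fun ω => by
    rw [setIntegral_congr_fun (g := I.indicator fun ρ => ρ * f (circlePoint x ρ ω))
      measurableSet_Ioi fun ρ hρ => ?_, setIntegral_indicator hI, inter_eq_right.2 hI0]
    by_cases hρI : ρ ∈ I <;> simp [indicator, dist_circlePoint x (le_of_lt hρ), hρI]
  simpa only [hin] using h

lemma radial_barrier_nonneg {r δ b ρ : ℝ} (hr : 0 < r) (hδ : 0 < δ)
    (hb : (3 * δ / (4 * r) + 2 * (r + δ) / δ) ^ 2 + 1 ≤ b * r) (hρ : ρ ∈ Icc r (r + δ)) :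
    0 ≤ (1 - ((ρ - r) / δ) ^ 2) - ρ * (2 * ((ρ - r) / δ) / δ)
      + b * ρ * (1 - (1 - ((ρ - r) / δ) ^ 2) ^ 2) - 3 / (4 * r) * ρ := by
  set M := 3 * δ / (4 * r) + 2 * (r + δ) / δ with hM
  obtain ⟨t, ht⟩ : ∃ t, t = (ρ - r) / δ := ⟨_, rfl⟩
  rw [← ht]
  have hρt : ρ = r + δ * t := by rw [ht]; field_simp; ring
  have ht0 : 0 ≤ t := by rw [ht]; exact div_nonneg (by linarith [hρ.1]) hδ.le
  have ht1 : t ≤ 1 := by rw [ht, div_le_one hδ]; linarith [hρ.2]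
  have hbpos : 0 < b := by
    by_contra! h
    nlinarith [sq_nonneg M, mul_nonneg (neg_nonneg.2 h) hr.le]
  have ht2 : t ^ 2 ≤ 1 := by nlinarith
  have h1 : M ^ 2 * t ^ 2 + t ^ 2 ≤ b * ρ * (1 - (1 - t ^ 2) ^ 2) := by
    have e1 : t ^ 2 ≤ 1 - (1 - t ^ 2) ^ 2 := by nlinarith [sq_nonneg t]
    have e2 : M ^ 2 + 1 ≤ b * ρ := hb.trans (mul_le_mul_of_nonneg_left hρ.1 hbpos.le)
    calc M ^ 2 * t ^ 2 + t ^ 2 = (M ^ 2 + 1) * t ^ 2 := by ring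
      _ ≤ _ := mul_le_mul e2 e1 (sq_nonneg t) (by nlinarith [sq_nonneg M])
  have h2 : ρ * (2 * t / δ) ≤ 2 * (r + δ) / δ * t := by
    calc ρ * (2 * t / δ) ≤ (r + δ) * (2 * t / δ) :=
          mul_le_mul_of_nonneg_right hρ.2 (by positivity)
      _ = _ := by ring
  have h3 : 3 / (4 * r) * ρ = 3 / 4 + 3 * δ / (4 * r) * t := by
    rw [hρt]; field_simp
  have h4 : M * t = 3 * δ / (4 * r) * t + 2 * (r + δ) / δ * t := by rw [hM]; ring
  nlinarith [sq_nonneg (1 / 2 - M * t)]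

/-- The one-dimensional Robin estimate along a ray leaving a disk of radius `r`. -/
lemma radial_robin_estimate {r δ b : ℝ} (hr : 0 < r) (hδ : 0 < δ)
    (hb : (3 * δ / (4 * r) + 2 * (r + δ) / δ) ^ 2 + 1 ≤ b * r) {v v' : ℝ → ℝ}
    (hv : ∀ ρ, HasDerivAt v (v' ρ) ρ) (hv' : Continuous v') :
    b * r * v r ^ 2 + (3 / (4 * r) * b - b ^ 2) * ∫ ρ in r..r + δ, ρ * v ρ ^ 2 ≤
      ∫ ρ in r..r + δ, ρ * v' ρ ^ 2 := by
  have hvc : Continuous v := continuous_iff_continuousAt.2 fun ρ => (hv ρ).continuousAt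
  have hbpos : 0 < b := by
    by_contra! h
    nlinarith [sq_nonneg (3 * δ / (4 * r) + 2 * (r + δ) / δ), mul_nonneg (neg_nonneg.2 h) hr.le]
  let h : ℝ → ℝ := fun ρ => 1 - ((ρ - r) / δ) ^ 2
  let h' : ℝ → ℝ := fun ρ => -(2 * ((ρ - r) / δ) / δ)
  have hh : ∀ ρ, HasDerivAt h (h' ρ) ρ := fun ρ => by
    have := ((((hasDerivAt_id ρ).sub_const r).div_const δ).pow 2).const_sub 1
    refine this.congr_deriv ?_
    simp only [h', id]
    push_cast
    ring
  let P' : ℝ → ℝ := fun ρ => -(b * ((h ρ + ρ * h' ρ) * v ρ ^ 2 + ρ * h ρ * (2 * v ρ * v' ρ)))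
  have hP : ∀ ρ, HasDerivAt (fun ρ => -(b * (ρ * h ρ * v ρ ^ 2))) (P' ρ) ρ := fun ρ => by
    have := ((((hasDerivAt_id ρ).mul (hh ρ)).mul ((hv ρ).pow 2)).const_mul b).neg
    refine this.congr_deriv ?_
    simp only [P', id, Pi.mul_apply, Pi.pow_apply]
    push_cast
    ring
  have hhc : Continuous h := by fun_prop
  have hhc' : Continuous h' := by fun_prop
  have hPc : Continuous P' := by fun_prop
  have hFTC := intervalIntegral.integral_eq_sub_of_hasDerivAt (fun ρ _ => hP ρ)
    (hPc.intervalIntegrable r (r + δ))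
  have hval : ∫ ρ in r..r + δ, P' ρ = b * r * v r ^ 2 := by
    rw [hFTC]
    simp [h, hδ.ne']
    ring
  rw [← hval, ← intervalIntegral.integral_const_mul, ← intervalIntegral.integral_add
    (hPc.intervalIntegrable _ _) ((by fun_prop : Continuous _).intervalIntegrable _ _)]
  refine intervalIntegral.integral_mono_on (by linarith)
    ((by fun_prop : Continuous _).intervalIntegrable _ _)
    ((by fun_prop : Continuous _).intervalIntegrable _ _) fun ρ hρ => ?_
  have hK := mul_nonneg (mul_nonneg hbpos.le (radial_barrier_nonneg hr hδ hb hρ))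
    (sq_nonneg (v ρ))
  have hsq := mul_nonneg (hr.le.trans hρ.1) (sq_nonneg (v' ρ + b * h ρ * v ρ))
  simp only [P', h, h'] at hsq ⊢
  linarith

lemma hasDerivAt_comp_circlePoint {u : E2 → ℝ} (hu : ContDiff ℝ (⊤ : ℕ∞) u) (x : E2)
    (ω : sphere (0 : ℂ) 1) (ρ : ℝ) :
    HasDerivAt (fun ρ => u (circlePoint x ρ ω))
      (fderiv ℝ u (circlePoint x ρ ω) (complexIsometry ω)) ρ := by
  have h1 : HasDerivAt (fun ρ : ℝ => circlePoint x ρ ω) (complexIsometry ω) ρ := by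
    simpa [circlePoint] using ((hasDerivAt_id ρ).smul_const (complexIsometry ω)).const_add x
  exact ((hu.differentiable (by simp)).differentiableAt.hasFDerivAt).comp_hasDerivAt ρ h1

lemma continuous_fderiv_of_smooth {u : E2 → ℝ} (hu : ContDiff ℝ (⊤ : ℕ∞) u) :
    Continuous (fderiv ℝ u) := hu.continuous_fderiv (by simp)

lemma integrable_sq_of_smooth {u : E2 → ℝ} (hu : ContDiff ℝ (⊤ : ℕ∞) u)
    (hc : HasCompactSupport u) : Integrable fun y => u y ^ 2 := by
  have h1 : Continuous fun y => u y ^ 2 := by have := hu.continuous; fun_prop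
  have h2 : HasCompactSupport fun y => u y ^ 2 :=
    hc.mono fun y hy h => hy (by simp [h])
  exact h1.integrable_of_hasCompactSupport h2

lemma integrable_norm_fderiv_sq {u : E2 → ℝ} (hu : ContDiff ℝ (⊤ : ℕ∞) u)
    (hc : HasCompactSupport u) : Integrable fun y => ‖fderiv ℝ u y‖ ^ 2 := by
  have h1 : Continuous fun y => ‖fderiv ℝ u y‖ ^ 2 := by
    have := continuous_fderiv_of_smooth hu
    fun_prop
  have h2 : HasCompactSupport fun y => ‖fderiv ℝ u y‖ ^ 2 :=
    (hc.fderiv ℝ).mono fun y hy h => hy (by simp [h])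
  exact h1.integrable_of_hasCompactSupport h2

/-- The Robin estimate on an annulus with coupling on the inner circle only. -/
lemma annulus_robin_estimate {C : ℝ} (hC : 0 < C) {x : E2} {r δ b : ℝ} (hr : 0 < r) (hδ : 0 < δ)
    (h : (μH[1] : Measure E2).restrict (sphere x r) =
      ENNReal.ofReal (C * r) • (volume : Measure ℂ).toSphere.map (circlePoint x r))
    (hb : (3 * δ / (4 * r) + 2 * (r + δ) / δ) ^ 2 + 1 ≤ b * r)
    {u : E2 → ℝ} (hu : ContDiff ℝ (⊤ : ℕ∞) u) (hc : HasCompactSupport u) :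
    b / C * ∫ y in sphere x r, u y ^ 2 ∂μH[1] +
        (3 / (4 * r) * b - b ^ 2) * ∫ y in {y | dist y x ∈ Ioo r (r + δ)}, u y ^ 2 ≤
      ∫ y in {y | dist y x ∈ Ioo r (r + δ)}, ‖fderiv ℝ u y‖ ^ 2 := by
  have hI : Ioo r (r + δ) ⊆ Ioi 0 := fun ρ hρ => hr.trans hρ.1
  obtain ⟨i1, e1⟩ := setIntegral_dist_mem x measurableSet_Ioo hI
    (integrable_sq_of_smooth hu hc).integrableOn
  obtain ⟨i2, e2⟩ := setIntegral_dist_mem x measurableSet_Ioo hI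
    (integrable_norm_fderiv_sq hu hc).integrableOn
  have hu2 : Continuous fun y => u y ^ 2 := by have := hu.continuous; fun_prop
  have i0 := integrable_comp_circlePoint hu2 x r
  rw [e1, e2, setIntegral_sphere_hausdorffMeasure hC hr h hu2]
  have hCr : b / C * (C * r * ∫ ω, u (circlePoint x r ω) ^ 2 ∂(volume : Measure ℂ).toSphere) =
      b * r * ∫ ω, u (circlePoint x r ω) ^ 2 ∂(volume : Measure ℂ).toSphere := by
    field_simp
  rw [hCr, ← integral_const_mul, ← integral_const_mul,
    ← integral_add (i0.const_mul _) (i1.const_mul _)]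
  refine integral_mono ((i0.const_mul _).add (i1.const_mul _)) i2 fun ω => ?_
  have hcp : Continuous fun ρ => circlePoint x ρ ω :=
    (continuous_circlePoint x).comp (Continuous.prodMk_right ω)
  have hfc := (continuous_fderiv_of_smooth hu).comp hcp
  have key := radial_robin_estimate hr hδ hb (hasDerivAt_comp_circlePoint hu x ω)
    (hfc.clm_apply continuous_const)
  have hle : r ≤ r + δ := by linarith
  have hconv : ∀ g : ℝ → ℝ, ∫ ρ in r..r + δ, g ρ = ∫ ρ in Ioo r (r + δ), g ρ := fun g => by
    rw [intervalIntegral.integral_of_le hle, integral_Ioc_eq_integral_Ioo]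
  have hmono : ∫ ρ in r..r + δ, ρ * (fderiv ℝ u (circlePoint x ρ ω) (complexIsometry ω)) ^ 2 ≤
      ∫ ρ in r..r + δ, ρ * ‖fderiv ℝ u (circlePoint x ρ ω)‖ ^ 2 := by
    refine intervalIntegral.integral_mono_on hle
      ((continuous_id.mul ((hfc.clm_apply continuous_const).pow 2)).intervalIntegrable _ _)
      ((continuous_id.mul (hfc.norm.pow 2)).intervalIntegrable _ _) fun ρ hρ => ?_
    refine mul_le_mul_of_nonneg_left ?_ (hr.le.trans hρ.1)
    have hω : ‖complexIsometry (ω : ℂ)‖ = 1 := by simp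
    have := (fderiv ℝ u (circlePoint x ρ ω)).le_opNorm (complexIsometry ω)
    rw [hω, mul_one] at this
    rw [← sq_abs, ← Real.norm_eq_abs]
    gcongr
  rw [hconv (fun ρ => ρ * ‖_‖ ^ 2)] at hmono
  rw [hconv (fun ρ => ρ * u (circlePoint x ρ ω) ^ 2)] at key
  exact key.trans hmono

/-- Lower bound for the Rayleigh quotient of the exterior of a set bounded by finitely many
circles of radius `r` that carry disjoint exterior collars of width `δ`. -/
lemma rayleigh_lower_bound {ι : Type*} [Fintype ι] {C : ℝ} (hC : 0 < C) {x : ι → E2}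
    {r δ b : ℝ} (hr : 0 < r) (hδ : 0 < δ)
    (h : ∀ i, (μH[1] : Measure E2).restrict (sphere (x i) r) =
      ENNReal.ofReal (C * r) • (volume : Measure ℂ).toSphere.map (circlePoint (x i) r))
    (hb : (3 * δ / (4 * r) + 2 * (r + δ) / δ) ^ 2 + 1 ≤ b * r) {Ω : Set E2}
    (hfr : frontier Ω ⊆ ⋃ i, sphere (x i) r)
    (hsphere : Pairwise (Function.onFun Disjoint fun i => sphere (x i) r))
    (hcollar : Pairwise (Function.onFun Disjoint fun i => {y | dist y (x i) ∈ Ioo r (r + δ)}))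
    (hext : ∀ i, {y | dist y (x i) ∈ Ioo r (r + δ)} ⊆ extDom Ω)
    {u : E2 → ℝ} (hu : ContDiff ℝ (⊤ : ℕ∞) u) (hc : HasCompactSupport u) :
    3 / (4 * r) * b - b ^ 2 ≤ ((∫ y in extDom Ω, ‖fderiv ℝ u y‖ ^ 2) +
      -(b / C) * ∫ y in frontier Ω, u y ^ 2 ∂μH[1]) / ∫ y in extDom Ω, u y ^ 2 := by
  have hbr : 1 ≤ b * r := by
    nlinarith [sq_nonneg (3 * δ / (4 * r) + 2 * (r + δ) / δ)]
  have hbpos : 0 < b := pos_of_mul_pos_left (by linarith) hr.le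
  have hneg : 3 / (4 * r) * b - b ^ 2 ≤ 0 := by
    have : 3 / (4 * r) ≤ b := by rw [div_le_iff₀ (by positivity)]; linarith
    nlinarith
  have hA : ∀ i, MeasurableSet {y | dist y (x i) ∈ Ioo r (r + δ)} := fun i =>
    (continuous_id.dist continuous_const).measurable measurableSet_Ioo
  have iu := integrable_sq_of_smooth hu hc
  have ig := integrable_norm_fderiv_sq hu hc
  have hu2 : Continuous fun y => u y ^ 2 := by have := hu.continuous; fun_prop
  have hs : ∀ i, IntegrableOn (fun y => u y ^ 2) (sphere (x i) r) μH[1] := fun i =>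
    integrableOn_sphere_hausdorffMeasure (h i) hu2
  have b1 : ∫ y in frontier Ω, u y ^ 2 ∂μH[1] ≤ ∑ i, ∫ y in sphere (x i) r, u y ^ 2 ∂μH[1] := by
    rw [← integral_iUnion_fintype (fun i => isClosed_sphere.measurableSet) hsphere hs]
    exact setIntegral_mono_set ((integrableOn_finite_iUnion).2 hs)
      (ae_of_all _ fun y => sq_nonneg _) hfr.eventuallyLE
  have b2 : ∑ i, ∫ y in {y | dist y (x i) ∈ Ioo r (r + δ)}, ‖fderiv ℝ u y‖ ^ 2 ≤
      ∫ y in extDom Ω, ‖fderiv ℝ u y‖ ^ 2 := by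
    rw [← integral_iUnion_fintype hA hcollar fun i => ig.integrableOn]
    exact setIntegral_mono_set ig.integrableOn
      (ae_of_all _ fun y => sq_nonneg _) (iUnion_subset hext).eventuallyLE
  have b3 : ∑ i, ∫ y in {y | dist y (x i) ∈ Ioo r (r + δ)}, u y ^ 2 ≤
      ∫ y in extDom Ω, u y ^ 2 := by
    rw [← integral_iUnion_fintype hA hcollar fun i => iu.integrableOn]
    exact setIntegral_mono_set iu.integrableOn
      (ae_of_all _ fun y => sq_nonneg _) (iUnion_subset hext).eventuallyLE
  have hsum := Finset.sum_le_sum fun i (_ : i ∈ Finset.univ) =>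
    annulus_robin_estimate hC hr hδ (h i) hb hu hc
  rw [Finset.sum_add_distrib, ← Finset.mul_sum, ← Finset.mul_sum] at hsum
  have m1 := mul_le_mul_of_nonneg_left b1 (div_pos hbpos hC).le
  have m3 := mul_le_mul_of_nonpos_left b3 hneg
  have hD : 0 ≤ ∫ y in extDom Ω, u y ^ 2 := integral_nonneg fun y => sq_nonneg _
  rcases hD.eq_or_lt with hD | hD
  · rw [← hD, div_zero]
    exact hneg
  · rw [le_div_iff₀ hD]
    linarith

/-- The first and third radial moments of the profile `exp (-k (ρ² - R²))²` outside radius `R`. -/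
lemma radial_moments {k R : ℝ} (hk : 0 < k) (hR : 0 < R) :
    (IntegrableOn (fun ρ => ρ * exp (-k * (ρ ^ 2 - R ^ 2)) ^ 2) (Ioi R) ∧
      ∫ ρ in Ioi R, ρ * exp (-k * (ρ ^ 2 - R ^ 2)) ^ 2 = 1 / (4 * k)) ∧
    (IntegrableOn (fun ρ => ρ ^ 3 * exp (-k * (ρ ^ 2 - R ^ 2)) ^ 2) (Ioi R) ∧
      ∫ ρ in Ioi R, ρ ^ 3 * exp (-k * (ρ ^ 2 - R ^ 2)) ^ 2 =
        R ^ 2 / (4 * k) + 1 / (8 * k ^ 2)) := by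
  have hW : ∀ ρ, HasDerivAt (fun ρ => exp (-k * (ρ ^ 2 - R ^ 2)) ^ 2)
      (-(4 * k * ρ) * exp (-k * (ρ ^ 2 - R ^ 2)) ^ 2) ρ := fun ρ => by
    have := ((((hasDerivAt_id ρ).pow 2).sub_const (R ^ 2)).const_mul (-k)).exp.pow 2
    refine this.congr_deriv ?_
    simp only [id, Pi.pow_apply]
    push_cast
    ring
  have hy : Tendsto (fun ρ : ℝ => 2 * k * ρ ^ 2) atTop atTop :=
    (tendsto_pow_atTop two_ne_zero).const_mul_atTop (by positivity)
  have hWy : ∀ ρ, exp (-k * (ρ ^ 2 - R ^ 2)) ^ 2 = exp (2 * k * R ^ 2) * exp (-(2 * k * ρ ^ 2)) :=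
    fun ρ => by rw [← exp_add, ← exp_nat_mul]; congr 1; push_cast; ring
  have t0 : Tendsto (fun ρ : ℝ => exp (-k * (ρ ^ 2 - R ^ 2)) ^ 2) atTop (nhds 0) := by
    have := ((tendsto_exp_neg_atTop_nhds_zero).comp hy).const_mul (exp (2 * k * R ^ 2))
    simpa only [hWy, mul_zero, Function.comp_def] using this
  have t2 : Tendsto (fun ρ : ℝ => ρ ^ 2 * exp (-k * (ρ ^ 2 - R ^ 2)) ^ 2) atTop (nhds 0) := by
    have := ((tendsto_pow_mul_exp_neg_atTop_nhds_zero 1).comp hy).const_mul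
      (exp (2 * k * R ^ 2) / (2 * k))
    rw [mul_zero] at this
    refine this.congr fun ρ => ?_
    simp only [Function.comp_apply, hWy]
    field_simp
  have d1 : ∀ ρ ∈ Ici R, HasDerivAt (fun ρ => -(1 / (4 * k)) * exp (-k * (ρ ^ 2 - R ^ 2)) ^ 2)
      (ρ * exp (-k * (ρ ^ 2 - R ^ 2)) ^ 2) ρ := fun ρ _ => by
    refine ((hW ρ).const_mul _).congr_deriv ?_
    field_simp
  have l1 : Tendsto (fun ρ : ℝ => -(1 / (4 * k)) * exp (-k * (ρ ^ 2 - R ^ 2)) ^ 2)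
      atTop (nhds 0) := by simpa using t0.const_mul (-(1 / (4 * k)))
  have n1 : ∀ ρ ∈ Ioi R, 0 ≤ ρ * exp (-k * (ρ ^ 2 - R ^ 2)) ^ 2 := fun ρ hρ =>
    mul_nonneg (hR.trans hρ).le (sq_nonneg _)
  have d3 : ∀ ρ ∈ Ici R, HasDerivAt
      (fun ρ => -(1 / (4 * k)) * (ρ ^ 2 * exp (-k * (ρ ^ 2 - R ^ 2)) ^ 2) +
        -(1 / (8 * k ^ 2)) * exp (-k * (ρ ^ 2 - R ^ 2)) ^ 2)
      (ρ ^ 3 * exp (-k * (ρ ^ 2 - R ^ 2)) ^ 2) ρ := fun ρ _ => by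
    refine (((((hasDerivAt_id ρ).pow 2).mul (hW ρ)).const_mul _).add
      ((hW ρ).const_mul _)).congr_deriv ?_
    simp only [id, Pi.pow_apply]
    push_cast
    field_simp
    ring
  have l3 : Tendsto (fun ρ : ℝ => -(1 / (4 * k)) * (ρ ^ 2 * exp (-k * (ρ ^ 2 - R ^ 2)) ^ 2) +
        -(1 / (8 * k ^ 2)) * exp (-k * (ρ ^ 2 - R ^ 2)) ^ 2) atTop (nhds 0) := by
    have := (t2.const_mul (-(1 / (4 * k)))).add (t0.const_mul (-(1 / (8 * k ^ 2))))
    rwa [mul_zero, mul_zero, add_zero] at this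
  have n3 : ∀ ρ ∈ Ioi R, 0 ≤ ρ ^ 3 * exp (-k * (ρ ^ 2 - R ^ 2)) ^ 2 := fun ρ hρ =>
    mul_nonneg (pow_nonneg (hR.trans hρ).le 3) (sq_nonneg _)
  refine ⟨⟨integrableOn_Ioi_deriv_of_nonneg' d1 n1 l1, ?_⟩,
    ⟨integrableOn_Ioi_deriv_of_nonneg' d3 n3 l3, ?_⟩⟩
  · rw [integral_Ioi_of_hasDerivAt_of_nonneg' d1 n1 l1]
    simp
  · rw [integral_Ioi_of_hasDerivAt_of_nonneg' d3 n3 l3]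
    simp
    ring

/-- A Gaussian profile in the squared radius, cut off at squared radius of order `ε⁻¹`. -/
def cutoffProfile (χ : ContDiffBump (0 : ℝ)) (k R ε s : ℝ) : ℝ :=
  exp (-k * (s - R ^ 2)) * χ (ε * s)

/-- The derivative of `cutoffProfile`. -/
def cutoffProfileDeriv (χ : ContDiffBump (0 : ℝ)) (k R ε s : ℝ) : ℝ :=
  exp (-k * (s - R ^ 2)) * (ε * deriv χ (ε * s) - k * χ (ε * s))

lemma hasDerivAt_cutoffProfile (χ : ContDiffBump (0 : ℝ)) (k R ε s : ℝ) :
    HasDerivAt (cutoffProfile χ k R ε) (cutoffProfileDeriv χ k R ε s) s := by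
  have h1 : HasDerivAt (fun s => exp (-k * (s - R ^ 2))) (exp (-k * (s - R ^ 2)) * (-k)) s := by
    simpa using (((hasDerivAt_id s).sub_const (R ^ 2)).const_mul (-k)).exp
  have h2 : HasDerivAt χ (deriv χ (ε * s)) (ε * s) :=
    ((χ.contDiff (n := 1)).differentiable (by simp)).differentiableAt.hasDerivAt
  have h3 : HasDerivAt (fun s => χ (ε * s)) (deriv χ (ε * s) * ε) s := by
    have h4 : HasDerivAt (fun s => ε * s) ε s := by simpa using (hasDerivAt_id s).const_mul ε
    exact h2.comp s h4
  refine (h1.mul h3).congr_deriv ?_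
  simp only [cutoffProfileDeriv]
  ring

lemma exists_bound_deriv_bump (χ : ContDiffBump (0 : ℝ)) : ∃ M, ∀ s, |deriv χ s| ≤ M :=
  (χ.hasCompactSupport.deriv).exists_bound_of_continuous
    ((χ.contDiff (n := 1)).continuous_deriv le_rfl)

lemma continuous_cutoffProfile (χ : ContDiffBump (0 : ℝ)) (k R ε : ℝ) :
    Continuous (cutoffProfile χ k R ε) := by
  have := χ.continuous
  unfold cutoffProfile
  fun_prop

lemma continuous_cutoffProfileDeriv (χ : ContDiffBump (0 : ℝ)) (k R ε : ℝ) :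
    Continuous (cutoffProfileDeriv χ k R ε) := by
  have := χ.continuous
  have := (χ.contDiff (n := 1)).continuous_deriv le_rfl
  unfold cutoffProfileDeriv
  fun_prop

lemma eventually_bump_eq_one (χ : ContDiffBump (0 : ℝ)) (s : ℝ) :
    ∀ᶠ n : ℕ in atTop, χ (1 / ((n : ℝ) + 1) * s) = 1 := by
  have h : Tendsto (fun n : ℕ => 1 / ((n : ℝ) + 1) * s) atTop (nhds 0) := by
    simpa using tendsto_one_div_add_atTop_nhds_zero_nat.mul_const s
  filter_upwards [h (ball_mem_nhds 0 χ.rIn_pos)] with n hn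
  exact χ.one_of_mem_closedBall (ball_subset_closedBall hn)

lemma one_div_nat_succ_mem_Icc (n : ℕ) : 1 / ((n : ℝ) + 1) ∈ Icc (0 : ℝ) 1 :=
  ⟨by positivity, by rw [div_le_one (by positivity)]; linarith [n.cast_nonneg (α := ℝ)]⟩

lemma tendsto_cutoffProfile_mass (χ : ContDiffBump (0 : ℝ)) {k R : ℝ} (hk : 0 < k) (hR : 0 < R) :
    Tendsto (fun n : ℕ => ∫ ρ in Ioi R, ρ * cutoffProfile χ k R (1 / ((n : ℝ) + 1)) (ρ ^ 2) ^ 2)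
      atTop (nhds (1 / (4 * k))) := by
  obtain ⟨⟨hi, he⟩, -⟩ := radial_moments hk hR
  rw [← he]
  refine tendsto_integral_of_dominated_convergence _ (fun n => ?_) hi (fun n => ?_) ?_
  · have := continuous_cutoffProfile χ k R (1 / ((n : ℝ) + 1))
    exact (by fun_prop : Continuous _).aestronglyMeasurable
  · filter_upwards [ae_restrict_mem measurableSet_Ioi] with ρ hρ
    have h0 : 0 ≤ ρ := (hR.trans hρ).le
    rw [Real.norm_of_nonneg (by positivity), cutoffProfile]
    have := χ.nonneg (x := 1 / ((n : ℝ) + 1) * ρ ^ 2)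
    gcongr
    exact mul_le_of_le_one_right (exp_pos _).le χ.le_one
  · refine ae_of_all _ fun ρ => tendsto_const_nhds.congr' ?_
    filter_upwards [eventually_bump_eq_one χ (ρ ^ 2)] with n hn
    rw [cutoffProfile, hn, mul_one]

lemma tendsto_cutoffProfile_energy (χ : ContDiffBump (0 : ℝ)) {k R : ℝ} (hk : 0 < k)
    (hR : 0 < R) :
    Tendsto (fun n : ℕ => ∫ ρ in Ioi R,
        ρ * (cutoffProfileDeriv χ k R (1 / ((n : ℝ) + 1)) (ρ ^ 2) * (2 * ρ)) ^ 2)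
      atTop (nhds (4 * k ^ 2 * (R ^ 2 / (4 * k) + 1 / (8 * k ^ 2)))) := by
  obtain ⟨-, hi, he⟩ := radial_moments hk hR
  obtain ⟨M, hM⟩ := exists_bound_deriv_bump χ
  have hM0 : 0 ≤ M := (abs_nonneg _).trans (hM 0)
  rw [← he, ← integral_const_mul]
  refine tendsto_integral_of_dominated_convergence
    (fun ρ => 4 * (M + k) ^ 2 * (ρ ^ 3 * exp (-k * (ρ ^ 2 - R ^ 2)) ^ 2))
    (fun n => ?_) (hi.const_mul _) (fun n => ?_) ?_
  · have := continuous_cutoffProfileDeriv χ k R (1 / ((n : ℝ) + 1))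
    exact (by fun_prop : Continuous _).aestronglyMeasurable
  · filter_upwards [ae_restrict_mem measurableSet_Ioi] with ρ hρ
    have h0 : 0 ≤ ρ := (hR.trans hρ).le
    obtain ⟨e0, e1⟩ := one_div_nat_succ_mem_Icc n
    set ε := 1 / ((n : ℝ) + 1)
    rw [Real.norm_of_nonneg (by positivity), cutoffProfileDeriv]
    have hb : |ε * deriv χ (ε * ρ ^ 2) - k * χ (ε * ρ ^ 2)| ≤ M + k := by
      refine (abs_sub _ _).trans (add_le_add ?_ ?_)
      · rw [abs_mul, abs_of_nonneg e0]
        exact (mul_le_of_le_one_left (abs_nonneg _) e1).trans (hM _)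
      · rw [abs_mul, abs_of_pos hk, abs_of_nonneg χ.nonneg]
        exact mul_le_of_le_one_right hk.le χ.le_one
    have hb2 : (ε * deriv χ (ε * ρ ^ 2) - k * χ (ε * ρ ^ 2)) ^ 2 ≤ (M + k) ^ 2 :=
      sq_le_sq' (abs_le.1 hb).1 (abs_le.1 hb).2
    calc _ = 4 * (ε * deriv χ (ε * ρ ^ 2) - k * χ (ε * ρ ^ 2)) ^ 2 *
          (ρ ^ 3 * exp (-k * (ρ ^ 2 - R ^ 2)) ^ 2) := by ring
      _ ≤ _ := by gcongr
  · refine ae_of_all _ fun ρ => ?_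
    have hε : Tendsto (fun n : ℕ => 1 / ((n : ℝ) + 1) * deriv χ (1 / ((n : ℝ) + 1) * ρ ^ 2))
        atTop (nhds 0) :=
      tendsto_one_div_add_atTop_nhds_zero_nat.zero_mul_isBoundedUnder_le
        (isBoundedUnder_of ⟨M, fun n => hM _⟩)
    have hχ : Tendsto (fun n : ℕ => χ (1 / ((n : ℝ) + 1) * ρ ^ 2)) atTop (nhds 1) :=
      tendsto_const_nhds.congr' ((eventually_bump_eq_one χ (ρ ^ 2)).mono fun n hn => hn.symm)
    have := ((((hε.sub (hχ.const_mul k)).const_mul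
      (exp (-k * (ρ ^ 2 - R ^ 2)))).mul_const (2 * ρ)).pow 2).const_mul ρ
    refine this.trans (le_of_eq ?_)
    congr 1
    ring

lemma extDom_ball (c : E2) {R : ℝ} (hR : 0 < R) :
    extDom (ball c R) = {y | dist y c ∈ Ioi R} := by
  ext y
  simp [extDom, closure_ball c hR.ne']

/-- The radial test function with profile `cutoffProfile`. -/
def radialTest (χ : ContDiffBump (0 : ℝ)) (k R ε : ℝ) (c y : E2) : ℝ :=
  cutoffProfile χ k R ε (‖y - c‖ ^ 2)

lemma norm_circlePoint_sub_sq (c : E2) (ρ : ℝ) (ω : sphere (0 : ℂ) 1) :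
    ‖circlePoint c ρ ω - c‖ ^ 2 = ρ ^ 2 := by
  have : ‖(ω : ℂ)‖ = 1 := by simp
  simp [circlePoint, norm_smul, this]

lemma contDiff_radialTest (χ : ContDiffBump (0 : ℝ)) (k R ε : ℝ) (c : E2) :
    ContDiff ℝ (⊤ : ℕ∞) (radialTest χ k R ε c) := by
  have h1 : ContDiff ℝ (⊤ : ℕ∞) fun y : E2 => ‖y - c‖ ^ 2 :=
    (contDiff_norm_sq ℝ).comp (contDiff_id.sub contDiff_const)
  have h2 : ContDiff ℝ (⊤ : ℕ∞) (cutoffProfile χ k R ε) := by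
    have := χ.contDiff (n := (⊤ : ℕ∞))
    unfold cutoffProfile
    fun_prop
  exact h2.comp h1

lemma hasCompactSupport_radialTest (χ : ContDiffBump (0 : ℝ)) (k R : ℝ) {ε : ℝ} (hε : 0 < ε)
    (c : E2) : HasCompactSupport (radialTest χ k R ε c) := by
  refine HasCompactSupport.intro (isCompact_closedBall c (√(χ.rOut / ε))) fun y hy => ?_
  rw [mem_closedBall, not_le, dist_eq_norm] at hy
  have h : χ.rOut ≤ ε * ‖y - c‖ ^ 2 := by
    have := (Real.sqrt_lt' ((Real.sqrt_nonneg _).trans_lt hy)).1 hy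
    rw [div_lt_iff₀ hε] at this
    linarith
  rw [radialTest, cutoffProfile, χ.zero_of_le_dist, mul_zero]
  rwa [dist_zero_right, Real.norm_of_nonneg (by positivity)]

lemma norm_fderiv_radialTest (χ : ContDiffBump (0 : ℝ)) (k R ε : ℝ) (c y : E2) :
    ‖fderiv ℝ (radialTest χ k R ε c) y‖ ^ 2 =
      (cutoffProfileDeriv χ k R ε (‖y - c‖ ^ 2) * (2 * ‖y - c‖)) ^ 2 := by
  have h1 : HasFDerivAt (fun y : E2 => ‖y - c‖ ^ 2) (2 • innerSL ℝ (y - c)) y := by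
    simpa using ((hasFDerivAt_id y).sub_const c).norm_sq
  have h2 := (hasDerivAt_cutoffProfile χ k R ε (‖y - c‖ ^ 2)).comp_hasFDerivAt y h1
  have h3 : fderiv ℝ (radialTest χ k R ε c) y =
      cutoffProfileDeriv χ k R ε (‖y - c‖ ^ 2) • (2 • innerSL ℝ (y - c)) := h2.fderiv
  rw [h3, norm_smul, ← Nat.cast_smul_eq_nsmul ℝ, norm_smul, innerSL_apply_norm]
  simp [mul_pow]

/-- Test functions whose Rayleigh quotient in the exterior of a disk of radius `R` is
arbitrarily close to `b / R - b ^ 2`. -/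
lemma exists_rayleigh_lt {C : ℝ} (hC : 0 < C) {c : E2} {R b L : ℝ} (hR : 0 < R) (hb : 0 < b)
    (h : (μH[1] : Measure E2).restrict (sphere c R) =
      ENNReal.ofReal (C * R) • (volume : Measure ℂ).toSphere.map (circlePoint c R))
    (hL : b / R - b ^ 2 < L) :
    ∃ u : E2 → ℝ, ContDiff ℝ (⊤ : ℕ∞) u ∧ HasCompactSupport u ∧
      (∃ y ∈ extDom (ball c R), u y ≠ 0) ∧
      ((∫ y in extDom (ball c R), ‖fderiv ℝ u y‖ ^ 2) +
        -(b / C) * ∫ y in frontier (ball c R), u y ^ 2 ∂μH[1]) /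
        (∫ y in extDom (ball c R), u y ^ 2) < L := by
  let χ : ContDiffBump (0 : ℝ) := ⟨1, 2, one_pos, one_lt_two⟩
  set k := b / (2 * R) with hk_def
  have hk : 0 < k := by positivity
  let ε : ℕ → ℝ := fun n => 1 / ((n : ℝ) + 1)
  have hε : ∀ n, 0 < ε n := fun n => by positivity
  set S := (volume : Measure ℂ).toSphere.real univ with hS_def
  have hS : 0 < S := by
    rw [hS_def, Measure.toSphere_real_apply_univ]
    exact mul_pos (by simp)
      (ENNReal.toReal_pos (measure_ball_pos _ _ one_pos).ne' measure_ball_lt_top.ne)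
  have hsub : Ioi R ⊆ Ioi 0 := Ioi_subset_Ioi hR.le
  have hD : ∀ n, ∫ y in extDom (ball c R), radialTest χ k R (ε n) c y ^ 2 =
      S * ∫ ρ in Ioi R, ρ * cutoffProfile χ k R (ε n) (ρ ^ 2) ^ 2 := fun n => by
    rw [extDom_ball c hR, (setIntegral_dist_mem c measurableSet_Ioi hsub
      (integrable_sq_of_smooth (contDiff_radialTest χ k R (ε n) c)
        (hasCompactSupport_radialTest χ k R (hε n) c)).integrableOn).2]
    simp only [radialTest, norm_circlePoint_sub_sq, integral_const, smul_eq_mul, hS_def]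
  have hG : ∀ n, ∫ y in extDom (ball c R), ‖fderiv ℝ (radialTest χ k R (ε n) c) y‖ ^ 2 =
      S * ∫ ρ in Ioi R, ρ * (cutoffProfileDeriv χ k R (ε n) (ρ ^ 2) * (2 * ρ)) ^ 2 := fun n => by
    rw [extDom_ball c hR, (setIntegral_dist_mem c measurableSet_Ioi hsub
      (integrable_norm_fderiv_sq (contDiff_radialTest χ k R (ε n) c)
        (hasCompactSupport_radialTest χ k R (hε n) c)).integrableOn).2]
    simp only [norm_fderiv_radialTest, mul_pow, norm_circlePoint_sub_sq, integral_const,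
      smul_eq_mul, hS_def]
  have hB : ∀ᶠ n in atTop, ∫ y in frontier (ball c R), radialTest χ k R (ε n) c y ^ 2 ∂μH[1] =
      C * R * S := by
    filter_upwards [eventually_bump_eq_one χ (R ^ 2)] with n hn
    have hu2 : Continuous fun y => radialTest χ k R (ε n) c y ^ 2 :=
      (contDiff_radialTest χ k R (ε n) c).continuous.pow 2
    rw [frontier_ball c hR.ne', setIntegral_sphere_hausdorffMeasure hC hR h hu2]
    simp [radialTest, norm_circlePoint_sub_sq, cutoffProfile, ε, hS_def, -one_div, hn]
  have hne : ∀ᶠ n in atTop, ∃ y ∈ extDom (ball c R), radialTest χ k R (ε n) c y ≠ 0 := by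
    filter_upwards [eventually_bump_eq_one χ ((R + 1) ^ 2)] with n hn
    refine ⟨circlePoint c (R + 1) 1, ?_, ?_⟩
    · rw [extDom_ball c hR, mem_ofPred_eq, dist_circlePoint c (by linarith)]
      simp
    · rw [radialTest, norm_circlePoint_sub_sq, cutoffProfile, hn, mul_one]
      exact (exp_pos _).ne'
  have hlim := (((tendsto_cutoffProfile_energy χ hk hR).const_mul S).add
    (tendsto_const_nhds (x := -(b / C) * (C * R * S)))).div
      ((tendsto_cutoffProfile_mass χ hk hR).const_mul S) (by positivity)
  have hval : (S * (4 * k ^ 2 * (R ^ 2 / (4 * k) + 1 / (8 * k ^ 2))) + -(b / C) * (C * R * S)) /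
      (S * (1 / (4 * k))) = b / R - b ^ 2 := by
    rw [hk_def]
    field_simp
    ring
  rw [hval] at hlim
  obtain ⟨n, h1, h2, h3⟩ := (hB.and (hne.and (hlim.eventually_lt_const hL))).exists
  refine ⟨radialTest χ k R (ε n) c, contDiff_radialTest χ k R (ε n) c,
    hasCompactSupport_radialTest χ k R (hε n) c, h2, ?_⟩
  rw [hD, hG, h1]
  exact h3

/-- Failure of the reverse isoperimetric inequality without convexity: for the union
of two disjoint disks, the disk of equal perimeter gives a strictly smaller exterior
eigenvalue in the strong coupling regime. -/
theorem nonconvex_counterexample_perimeter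
    (r : ℝ) (hr : 0 < r) (x₁ x₂ c : E2) (hsep : 2 * r < dist x₁ x₂) :
    ∃ α₀ < (0:ℝ), ∀ α < α₀,
      robinEig α (ball c (2 * r)) < robinEig α (ball x₁ r ∪ ball x₂ r) := by
  obtain ⟨C, hC, hμ⟩ := exists_hausdorffMeasure_restrict_sphere
  have hR : 0 < 2 * r := by positivity
  set δ := (dist x₁ x₂ - 2 * r) / 2 with hδ_def
  have hδ : 0 < δ := by rw [hδ_def]; linarith
  set M₁ := (3 * δ / (4 * r) + 2 * (r + δ) / δ) ^ 2 + 1 with hM₁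
  set M₂ := (3 * δ / (4 * (2 * r)) + 2 * (2 * r + δ) / δ) ^ 2 + 1 with hM₂
  have hM₁0 : 0 < M₁ := by positivity
  have hM₂0 : 0 < M₂ := by positivity
  refine ⟨-((M₁ + M₂) / r / C), neg_lt_zero.2 (by positivity), fun α hα => ?_⟩
  obtain ⟨b, rfl⟩ : ∃ b, α = -(b / C) := ⟨-α * C, by field_simp⟩
  have hb : M₁ + M₂ < b * r := by
    rwa [neg_lt_neg_iff, div_lt_div_iff_of_pos_right hC, div_lt_iff₀ hr] at hα
  have hbpos : 0 < b := pos_of_mul_pos_left (by linarith) hr.le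
  have hlow : 3 / (4 * r) * b - b ^ 2 ≤ robinEig (-(b / C)) (ball x₁ r ∪ ball x₂ r) := by
    let x : Bool → E2 := fun i => cond i x₁ x₂
    have hdist : ∀ i j, i ≠ j → dist (x i) (x j) = 2 * r + 2 * δ := fun i j hij => by
      have : dist x₁ x₂ = 2 * r + 2 * δ := by rw [hδ_def]; ring
      rcases i with _ | _ <;> rcases j with _ | _
      · exact absurd rfl hij
      · exact (dist_comm x₂ x₁).trans this
      · exact this
      · exact absurd rfl hij
    have hΩ : ball x₁ r ∪ ball x₂ r = ⋃ i, ball (x i) r := by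
      rw [union_eq_iUnion]
      exact iUnion_congr fun i => by cases i <;> rfl
    rw [hΩ]
    have hcl : closure (⋃ i, ball (x i) r) = ⋃ i, closedBall (x i) r := by
      rw [closure_iUnion_of_finite]
      exact iUnion_congr fun i => closure_ball _ hr.ne'
    refine Real.le_sInf ?_ ?_
    · rintro q ⟨u, hu, hc, -, rfl⟩
      refine rayleigh_lower_bound hC hr hδ (fun i => hμ (x i) r hr) (by linarith) ?_ ?_ ?_ ?_ hu hc
      · intro y hy
        obtain ⟨hy1, hy2⟩ := hy
        rw [hcl, mem_iUnion] at hy1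
        obtain ⟨i, hi⟩ := hy1
        rw [(isOpen_iUnion fun i => isOpen_ball).interior_eq, mem_iUnion, not_exists] at hy2
        exact mem_iUnion.2 ⟨i, le_antisymm hi (not_lt.1 (hy2 i))⟩
      · intro i j hij
        refine disjoint_left.2 fun y hi hj => ?_
        have := dist_triangle_left (x i) (x j) y
        rw [mem_sphere] at hi hj
        linarith [hdist i j hij]
      · intro i j hij
        refine disjoint_left.2 fun y hi hj => ?_
        have := dist_triangle_left (x i) (x j) y
        linarith [hdist i j hij, hi.2, hj.2]
      · intro i y hy
        rw [extDom, hcl, mem_compl_iff, mem_iUnion, not_exists]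
        intro j hj
        rw [mem_closedBall] at hj
        by_cases hij : i = j
        · subst hij
          exact absurd hj (not_le.2 hy.1)
        · have := dist_triangle_left (x i) (x j) y
          linarith [hdist i j hij, hy.2]
    · have : 3 / (4 * r) ≤ b := by
        rw [div_le_iff₀ (by positivity)]
        nlinarith [sq_nonneg (3 * δ / (4 * r) + 2 * (r + δ) / δ)]
      nlinarith
  refine lt_of_lt_of_le ?_ hlow
  obtain ⟨u, hu, hc, hne, hlt⟩ := exists_rayleigh_lt hC (c := c) hR hbpos (hμ c (2 * r) hR)
    (L := 3 / (4 * r) * b - b ^ 2) (by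
      have : 3 / (4 * r) * b - b / (2 * r) = b / (4 * r) := by field_simp; ring
      have : 0 < b / (4 * r) := by positivity
      linarith)
  refine lt_of_le_of_lt (csInf_le ⟨3 / (4 * (2 * r)) * b - b ^ 2, ?_⟩ ⟨u, hu, hc, hne, rfl⟩) hlt
  rintro q ⟨v, hv, hvc, -, rfl⟩
  refine rayleigh_lower_bound (ι := Unit) (x := fun _ => c) hC hR hδ (fun _ => hμ c (2 * r) hR)
    (by linarith) ?_ (Subsingleton.pairwise) (Subsingleton.pairwise) (fun _ => ?_) hv hvc
  · rw [frontier_ball c hR.ne', iUnion_const]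
  · rw [extDom_ball c hR]
    exact fun y hy => hy.1

end
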